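/- arXiv:1210.1821 — 9 statements merged into one kernel-verified Lean document; each statement's English description precedes it below -/
import Mathlib

section
/- Let (N, P) be a Nijenhuis algebra over a field k. Define binary operations on N by x ≺ y := x·P(y), x ≻ y := P(x)·y, and x • y := −P(x·y), and set x ★ y := x ≺ y + x ≻ y + x • y. Then (N, ≺, ≻, •) is an NS algebra, i.e. for all x, y, z ∈ N: (x ≺ y) ≺ z = x ≺ (y ★ z), (x ≻ y) ≺ z = x ≻ (y ≺ z), (x ★ y) ≻ z = x ≻ (y ≻ z), and (x ★ y) • z + (x • y) ≺ z = x ≻ (y • z) + x • (y ★ z). -/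
/-- A Nijenhuis algebra `(N, P)` induces an NS algebra structure via
`x ≺ y = x·P(y)`, `x ≻ y = P(x)·y`, `x • y = −P(x·y)`. -/
theorem nijenhuis_gives_NS
    (k : Type*) [Field k] (N : Type*) [NonUnitalRing N]
    [Module k N] [IsScalarTower k N N] [SMulCommClass k N N]
    (P : N →ₗ[k] N)
    (hP : ∀ x y : N, P x * P y = P (P x * y) + P (x * P y) - P (P (x * y)))
    (prec succ bul star : N → N → N)
    (hprec : ∀ x y : N, prec x y = x * P y)
    (hsucc : ∀ x y : N, succ x y = P x * y)
    (hbul : ∀ x y : N, bul x y = - P (x * y))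
    (hstar : ∀ x y : N, star x y = prec x y + succ x y + bul x y) :
    ∀ x y z : N,
      prec (prec x y) z = prec x (star y z) ∧
      prec (succ x y) z = succ x (prec y z) ∧
      succ (star x y) z = succ x (succ y z) ∧
      bul (star x y) z + prec (bul x y) z = succ x (bul y z) + bul x (star y z) := by
  have hPstar : ∀ x y : N, P (star x y) = P x * P y := by
    intro x y
    rw [hstar, hprec, hsucc, hbul, hP, map_add, map_add, map_neg]
    abel
  intro x y z
  refine ⟨?_, ?_, ?_, ?_⟩
  · rw [hprec, hprec, hprec, hPstar, mul_assoc]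
  · rw [hprec, hsucc, hsucc, hprec, mul_assoc]
  · rw [hsucc, hsucc, hsucc, hPstar, mul_assoc]
  · simp only [hstar, hprec, hsucc, hbul, add_mul, mul_add, neg_mul, mul_neg, map_add, map_neg,
      hP (x * y) z, hP x (y * z), mul_assoc]
    abel
end

section
/- Let (N, P) be a Nijenhuis algebra over a field k. Then for all x, y, z ∈ N: −P(P(x)·y·z) − P(x·y)·P(z) + P(P(x·y)·z) = −P(x)·P(y·z) − P(x·y·P(z)) + P(x·P(y·z)). Equivalently, with x ≺ y := x·P(y), x ≻ y := P(x)·y, x • y := −P(x·y), one has (x ≻ y) • z + (x • y) ≺ z + (x • y) • z = x ≻ (y • z) + x • (y ≺ z) + x • (y • z). -/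
theorem nijenhuis_bullet_relation
    (k : Type*) [Field k] (N : Type*) [NonUnitalRing N]
    [Module k N] [IsScalarTower k N N] [SMulCommClass k N N]
    (P : N →ₗ[k] N)
    (hP : ∀ x y : N, P x * P y = P (P x * y) + P (x * P y) - P (P (x * y)))
    (prec succ bul : N → N → N)
    (hprec : ∀ x y : N, prec x y = x * P y)
    (hsucc : ∀ x y : N, succ x y = P x * y)
    (hbul : ∀ x y : N, bul x y = - P (x * y)) :
    ∀ x y z : N,
      (- P (P x * y * z) - P (x * y) * P z + P (P (x * y) * z)
        = - (P x * P (y * z)) - P (x * y * P z) + P (x * P (y * z))) ∧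
      bul (succ x y) z + prec (bul x y) z + bul (bul x y) z
        = succ x (bul y z) + bul x (prec y z) + bul x (bul y z) := by
  intro x y z
  have key : - P (P x * y * z) - P (x * y) * P z + P (P (x * y) * z)
      = - (P x * P (y * z)) - P (x * y * P z) + P (x * P (y * z)) := by
    rw [hP (x * y) z, hP x (y * z)]
    simp only [mul_assoc]
    abel
  refine ⟨key, ?_⟩
  simp only [hprec, hsucc, hbul, neg_mul, mul_neg, map_neg, neg_neg]
  simpa only [sub_eq_add_neg, mul_assoc] using key
end

section
/- Let (N, P) be a Nijenhuis algebra over a field k. Define x ≺ y := x·P(y), x ≻ y := P(x)·y, x • y := −P(x·y), and x ★ y := x ≺ y + x ≻ y + x • y. Then for all x, y, z ∈ N: (x ★ y) • z + (x • y) ≺ z = x ≻ (y • z) + x • (y ★ z). -/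
theorem nijenhuis_fourth_NS_relation
    (k : Type*) [Field k] (N : Type*) [NonUnitalRing N]
    [Module k N] [IsScalarTower k N N] [SMulCommClass k N N]
    (P : N →ₗ[k] N)
    (hP : ∀ x y : N, P x * P y = P (P x * y) + P (x * P y) - P (P (x * y)))
    (prec succ bul : N → N → N)
    (hprec : ∀ x y : N, prec x y = x * P y)
    (hsucc : ∀ x y : N, succ x y = P x * y)
    (hbul : ∀ x y : N, bul x y = - P (x * y))
    (star : N → N → N)
    (hstar : ∀ x y : N, star x y = prec x y + succ x y + bul x y) :
    ∀ x y z : N,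
      bul (star x y) z + prec (bul x y) z = succ x (bul y z) + bul x (star y z) := by
  intro x y z
  simp only [hstar, hprec, hsucc, hbul, neg_mul, mul_neg, hP (x * y) z, hP x (y * z),
    add_mul, mul_add, map_add, map_neg, mul_assoc]
  abel
end

section
/- Let (N, P) be a Nijenhuis algebra over a field k. Define x ≺ y := x·P(y), x ≻ y := P(x)·y, x • y := −P(x·y), and x ★ y := x ≺ y + x ≻ y + x • y. Then for all x, y, z ∈ N: (x ★ y) ≻ z = x ≻ (y ≻ z). -/
theorem nijenhuis_third_NS_relation
    (k : Type*) [Field k] (N : Type*) [NonUnitalRing N]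
    [Module k N] [IsScalarTower k N N] [SMulCommClass k N N]
    (P : N →ₗ[k] N)
    (hP : ∀ x y : N, P x * P y = P (P x * y) + P (x * P y) - P (P (x * y)))
    (prec succ bul : N → N → N)
    (hprec : ∀ x y : N, prec x y = x * P y)
    (hsucc : ∀ x y : N, succ x y = P x * y)
    (hbul : ∀ x y : N, bul x y = - P (x * y))
    (star : N → N → N)
    (hstar : ∀ x y : N, star x y = prec x y + succ x y + bul x y) :
    ∀ x y z : N, succ (star x y) z = succ x (succ y z) := by
  intro x y z
  simp only [hstar, hprec, hsucc, hbul]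
  rw [← mul_assoc, hP, map_add, map_add, map_neg, ← sub_eq_add_neg, add_comm (P (x * P y))]
end

section
/- Let (N, P) be a Nijenhuis algebra over a field k. Define x ≺ y := x·P(y), x ≻ y := P(x)·y, and x • y := −P(x·y). Then (N, ≺, ≻, •) is an N-dendriform algebra, i.e. for all x, y, z ∈ N the following five relations hold: (x ≺ y) ≺ z = x ≺ (y ≺ z) + x ≺ (y ≻ z) + x ≺ (y • z); (x ≻ y) ≺ z = x ≻ (y ≺ z); (x ≺ y) ≻ z + (x ≻ y) ≻ z + (x • y) ≻ z = x ≻ (y ≻ z); (x ≺ y) • z = x • (y ≻ z); and (x ≻ y) • z + (x • y) ≺ z + (x • y) • z = x ≻ (y • z) + x • (y ≺ z) + x • (y • z). -/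
theorem nijenhuis_gives_N_dendriform
    (k : Type*) [Field k] (N : Type*) [NonUnitalRing N]
    [Module k N] [IsScalarTower k N N] [SMulCommClass k N N]
    (P : N →ₗ[k] N)
    (hP : ∀ x y : N, P x * P y = P (P x * y) + P (x * P y) - P (P (x * y)))
    (prec succ bul : N → N → N)
    (hprec : ∀ x y : N, prec x y = x * P y)
    (hsucc : ∀ x y : N, succ x y = P x * y)
    (hbul : ∀ x y : N, bul x y = - P (x * y)) :
    ∀ x y z : N,
      prec (prec x y) z = prec x (prec y z) + prec x (succ y z) + prec x (bul y z) ∧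
      prec (succ x y) z = succ x (prec y z) ∧
      succ (prec x y) z + succ (succ x y) z + succ (bul x y) z = succ x (succ y z) ∧
      bul (prec x y) z = bul x (succ y z) ∧
      bul (succ x y) z + prec (bul x y) z + bul (bul x y) z
        = succ x (bul y z) + bul x (prec y z) + bul x (bul y z) := by
  intro x y z
  simp only [hprec, hsucc, hbul, map_neg, mul_neg, neg_mul, neg_neg]
  refine ⟨?_, ?_, ?_, ?_, ?_⟩
  · rw [mul_assoc, hP y z, mul_sub, mul_add]
    abel
  · rw [mul_assoc]
  · rw [← mul_assoc, hP x y, sub_mul, add_mul]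
    abel
  · rw [mul_assoc]
  · rw [hP (x * y) z, hP x (y * z)]
    simp only [mul_assoc]
    abel
end

section
/- Let (N, P) be a Nijenhuis algebra over a field k. Then the binary operation x ★ y := x·P(y) + P(x)·y − P(x·y) is associative on N: (x ★ y) ★ z = x ★ (y ★ z) for all x, y, z ∈ N. -/
theorem nijenhuis_star_assoc
    (k : Type*) [Field k] (N : Type*) [NonUnitalRing N]
    [Module k N] [IsScalarTower k N N] [SMulCommClass k N N]
    (P : N →ₗ[k] N)
    (hP : ∀ x y : N, P x * P y = P (P x * y) + P (x * P y) - P (P (x * y)))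
    (star : N → N → N)
    (hstar : ∀ x y : N, star x y = x * P y + P x * y - P (x * y)) :
    ∀ x y z : N, star (star x y) z = star x (star y z) := by
  intro x y z
  have map_star (a b : N) : P (star a b) = P a * P b := by
    rw [hstar, hP, map_sub, map_add, add_comm (P (a * P b))]
  have left := hP (x * y) z
  have right := hP x (y * z)
  rw [hstar (star x y) z, hstar x (star y z), map_star, map_star, hstar, hstar]
  simp only [mul_add, add_mul, mul_sub, sub_mul, map_add, map_sub, mul_assoc] at left right ⊢
  rw [left, right]
  abel
end

section
/- For every (possibly nonunital) associative algebra A over a field k there exists a free Nijenhuis algebra on A: a Nijenhuis algebra (F, P) together with a k-algebra homomorphism j : A → F such that for every Nijenhuis algebra (N, Q) and every k-algebra homomorphism f : A → N there is a unique k-algebra homomorphism f̄ : F → N satisfying f̄ ∘ P = Q ∘ f̄ and f̄ ∘ j = f. -/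
universe u v

/-- A bundled Nijenhuis algebra over a field `k`: a nonunital associative `k`-algebra
together with a linear operator `P` satisfying the Nijenhuis equation. -/
structure NijAlg (k : Type v) [Field k] where
  carrier : Type u
  [ring : NonUnitalRing carrier]
  [mod : Module k carrier]
  [tower : IsScalarTower k carrier carrier]
  [comm : SMulCommClass k carrier carrier]
  P : carrier →ₗ[k] carrier
  nij : ∀ x y : carrier, P x * P y = P (P x * y) + P (x * P y) - P (P (x * y))

attribute [instance] NijAlg.ring NijAlg.mod NijAlg.tower NijAlg.comm

/-- Formal expressions in the operations of a Nijenhuis algebra, with generators from `A` and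
scalars from `K`. -/
inductive NijTerm (K A : Type u) : Type u
  | of (a : A) : NijTerm K A
  | zero : NijTerm K A
  | add (x y : NijTerm K A) : NijTerm K A
  | neg (x : NijTerm K A) : NijTerm K A
  | mul (x y : NijTerm K A) : NijTerm K A
  | smul (c : K) (x : NijTerm K A) : NijTerm K A
  | op (x : NijTerm K A) : NijTerm K A

namespace NijTerm

variable {k : Type v} [Field k] {K A : Type u}

/-- The value of a formal expression in a Nijenhuis algebra, where `e` interprets the scalars
and `f` the generators. -/
def eval (e : K ≃ k) (N : NijAlg.{u} k) (f : A → N.carrier) : NijTerm K A → N.carrier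
  | of a => f a
  | zero => 0
  | add x y => eval e N f x + eval e N f y
  | neg x => -eval e N f x
  | mul x y => eval e N f x * eval e N f y
  | smul c x => e c • eval e N f x
  | op x => N.P (eval e N f x)

/-- Two expressions are identified when every algebra homomorphism from `A` to a Nijenhuis
algebra gives them the same value. -/
def evalSetoid (A : Type u) [NonUnitalRing A] [Module k A] (e : K ≃ k) :
    Setoid (NijTerm K A) where
  r x y := ∀ (N : NijAlg.{u} k) (f : A →ₙₐ[k] N.carrier), eval e N f x = eval e N f y
  iseqv :=
    ⟨fun _ _ _ => rfl, fun h N f => (h N f).symm, fun h₁ h₂ N f => (h₁ N f).trans (h₂ N f)⟩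

end NijTerm

/-- The free Nijenhuis algebra on `A`, as a quotient of the formal expressions. The scalars are
represented, through `e`, in the universe of `A`. -/
def FreeNij {k : Type v} [Field k] {K : Type u} (A : Type u) [NonUnitalRing A] [Module k A]
    (e : K ≃ k) : Type u :=
  Quotient (NijTerm.evalSetoid A e)

namespace FreeNij

open NijTerm

variable {k : Type v} [Field k] {K A : Type u} [NonUnitalRing A] [Module k A] {e : K ≃ k}

/-- The class of a formal expression. -/
def mk (e : K ≃ k) (x : NijTerm K A) : FreeNij A e := Quotient.mk _ x

theorem mk_surjective (x : FreeNij A e) : ∃ t, mk e t = x := Quotient.exists_rep x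

theorem mk_eq {x y : NijTerm K A}
    (h : ∀ (N : NijAlg.{u} k) (f : A →ₙₐ[k] N.carrier), eval e N f x = eval e N f y) :
    mk e x = mk e y :=
  Quotient.sound h

instance : Zero (FreeNij A e) := ⟨mk e zero⟩

instance : Add (FreeNij A e) :=
  ⟨Quotient.map₂ add fun _ _ h₁ _ _ h₂ N f => congrArg₂ (· + ·) (h₁ N f) (h₂ N f)⟩

instance : Neg (FreeNij A e) :=
  ⟨Quotient.map neg fun _ _ h N f => congrArg (- ·) (h N f)⟩

instance : Mul (FreeNij A e) :=
  ⟨Quotient.map₂ mul fun _ _ h₁ _ _ h₂ N f => congrArg₂ (· * ·) (h₁ N f) (h₂ N f)⟩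

instance : SMul k (FreeNij A e) :=
  ⟨fun c => Quotient.map (smul (e.symm c)) fun _ _ h N f =>
    congrArg (e (e.symm c) • ·) (h N f)⟩

theorem mk_zero : mk e (zero : NijTerm K A) = 0 := rfl

theorem mk_add (x y : NijTerm K A) : mk e (add x y) = mk e x + mk e y := rfl

theorem mk_neg (x : NijTerm K A) : mk e (neg x) = -mk e x := rfl

theorem mk_mul (x y : NijTerm K A) : mk e (mul x y) = mk e x * mk e y := rfl

theorem mk_smul_symm (c : k) (x : NijTerm K A) : mk e (smul (e.symm c) x) = c • mk e x := rfl

theorem mk_smul (c : K) (x : NijTerm K A) : mk e (smul c x) = e c • mk e x := by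
  rw [← mk_smul_symm, e.symm_apply_apply]

instance : NonUnitalRing (FreeNij A e) where
  add_assoc := by
    rintro ⟨x⟩ ⟨y⟩ ⟨z⟩
    exact mk_eq (x := add (add x y) z) (y := add x (add y z)) fun N f => add_assoc _ _ _
  zero_add := by
    rintro ⟨x⟩
    exact mk_eq (x := add zero x) (y := x) fun N f => zero_add _
  add_zero := by
    rintro ⟨x⟩
    exact mk_eq (x := add x zero) (y := x) fun N f => add_zero _
  nsmul := nsmulRec
  zsmul := zsmulRec
  neg_add_cancel := by
    rintro ⟨x⟩
    exact mk_eq (x := add (neg x) x) (y := zero) fun N f => neg_add_cancel _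
  add_comm := by
    rintro ⟨x⟩ ⟨y⟩
    exact mk_eq (x := add x y) (y := add y x) fun N f => add_comm _ _
  left_distrib := by
    rintro ⟨x⟩ ⟨y⟩ ⟨z⟩
    exact mk_eq (x := mul x (add y z)) (y := add (mul x y) (mul x z)) fun N f => mul_add _ _ _
  right_distrib := by
    rintro ⟨x⟩ ⟨y⟩ ⟨z⟩
    exact mk_eq (x := mul (add x y) z) (y := add (mul x z) (mul y z)) fun N f => add_mul _ _ _
  zero_mul := by
    rintro ⟨x⟩
    exact mk_eq (x := mul zero x) (y := zero) fun N f => zero_mul _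
  mul_zero := by
    rintro ⟨x⟩
    exact mk_eq (x := mul x zero) (y := zero) fun N f => mul_zero _
  mul_assoc := by
    rintro ⟨x⟩ ⟨y⟩ ⟨z⟩
    exact mk_eq (x := mul (mul x y) z) (y := mul x (mul y z)) fun N f => mul_assoc _ _ _

instance : Module k (FreeNij A e) where
  one_smul x := by
    obtain ⟨x, rfl⟩ := mk_surjective x
    rw [← mk_smul_symm]
    exact mk_eq fun N f => by simp [eval]
  mul_smul a b x := by
    obtain ⟨x, rfl⟩ := mk_surjective x
    simp only [← mk_smul_symm]
    exact mk_eq fun N f => by simp [eval, mul_smul]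
  smul_zero a := by
    simp only [← mk_zero, ← mk_smul_symm]
    exact mk_eq fun N f => by simp [eval]
  smul_add a x y := by
    obtain ⟨x, rfl⟩ := mk_surjective x
    obtain ⟨y, rfl⟩ := mk_surjective y
    simp only [← mk_add, ← mk_smul_symm]
    exact mk_eq fun N f => by simp [eval]
  add_smul a b x := by
    obtain ⟨x, rfl⟩ := mk_surjective x
    simp only [← mk_add, ← mk_smul_symm]
    exact mk_eq fun N f => by simp [eval, add_smul]
  zero_smul x := by
    obtain ⟨x, rfl⟩ := mk_surjective x
    simp only [← mk_zero, ← mk_smul_symm]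
    exact mk_eq fun N f => by simp [eval]

instance : IsScalarTower k (FreeNij A e) (FreeNij A e) where
  smul_assoc a x y := by
    obtain ⟨x, rfl⟩ := mk_surjective x
    obtain ⟨y, rfl⟩ := mk_surjective y
    simp only [smul_eq_mul, ← mk_mul, ← mk_smul_symm]
    exact mk_eq fun N f =>
      smul_mul_assoc (e (e.symm a)) (eval e N f x) (eval e N f y)

instance : SMulCommClass k (FreeNij A e) (FreeNij A e) where
  smul_comm a x y := by
    obtain ⟨x, rfl⟩ := mk_surjective x
    obtain ⟨y, rfl⟩ := mk_surjective y
    simp only [smul_eq_mul, ← mk_mul, ← mk_smul_symm]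
    exact mk_eq fun N f =>
      (mul_smul_comm (e (e.symm a)) (eval e N f x) (eval e N f y)).symm

/-- The Nijenhuis operator of the free Nijenhuis algebra. -/
def operator : FreeNij A e →ₗ[k] FreeNij A e where
  toFun := Quotient.map op fun _ _ h N f => congrArg N.P (h N f)
  map_add' := by
    rintro ⟨x⟩ ⟨y⟩
    exact mk_eq (x := op (add x y)) (y := add (op x) (op y)) fun N f => map_add N.P _ _
  map_smul' := by
    rintro c ⟨x⟩
    exact mk_eq (x := op (smul (e.symm c) x)) (y := smul (e.symm c) (op x)) fun N f =>
      map_smul N.P _ _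

theorem mk_op (x : NijTerm K A) : mk e (op x) = operator (mk e x) := rfl

/-- The free Nijenhuis algebra as a bundled Nijenhuis algebra. -/
def nijAlg (A : Type u) [NonUnitalRing A] [Module k A] (e : K ≃ k) : NijAlg.{u} k where
  carrier := FreeNij A e
  P := operator
  nij x y := by
    obtain ⟨x, rfl⟩ := mk_surjective x
    obtain ⟨y, rfl⟩ := mk_surjective y
    simp only [sub_eq_add_neg, ← mk_op, ← mk_mul, ← mk_add, ← mk_neg]
    exact mk_eq fun N f => by simp [eval, N.nij, sub_eq_add_neg]

/-- The inclusion of the generators. -/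
def incl (A : Type u) [NonUnitalRing A] [Module k A] (e : K ≃ k) : A →ₙₐ[k] FreeNij A e where
  toFun a := mk e (of a)
  map_smul' c a := by
    rw [MonoidHom.id_apply, ← mk_smul_symm]
    exact mk_eq fun N f => by simp [eval]
  map_zero' := mk_eq fun N f => map_zero f
  map_add' a b := mk_eq (y := add (of a) (of b)) fun N f => map_add f a b
  map_mul' a b := mk_eq (y := mul (of a) (of b)) fun N f => map_mul f a b

/-- The extension of an algebra homomorphism to the free Nijenhuis algebra. -/
def lift (e : K ≃ k) (N : NijAlg.{u} k) (f : A →ₙₐ[k] N.carrier) :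
    FreeNij A e →ₙₐ[k] N.carrier where
  toFun := Quotient.lift (eval e N f) fun _ _ h => h N f
  map_smul' := by
    rintro c ⟨x⟩
    exact congrArg (· • eval e N f x) (e.apply_symm_apply c)
  map_zero' := rfl
  map_add' := by
    rintro ⟨x⟩ ⟨y⟩
    rfl
  map_mul' := by
    rintro ⟨x⟩ ⟨y⟩
    rfl

theorem lift_operator (N : NijAlg.{u} k) (f : A →ₙₐ[k] N.carrier) (x : FreeNij A e) :
    lift e N f (operator x) = N.P (lift e N f x) := by
  obtain ⟨x, rfl⟩ := mk_surjective x
  rfl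

theorem lift_incl (N : NijAlg.{u} k) (f : A →ₙₐ[k] N.carrier) (a : A) :
    lift e N f (incl A e a) = f a := rfl

theorem eq_lift (N : NijAlg.{u} k) (f : A →ₙₐ[k] N.carrier) (g : FreeNij A e →ₙₐ[k] N.carrier)
    (hP : ∀ x, g (operator x) = N.P (g x)) (hf : ∀ a, g (incl A e a) = f a) :
    g = lift e N f := by
  ext x
  obtain ⟨x, rfl⟩ := mk_surjective x
  change g (mk e x) = eval e N f x
  induction x with
  | of a => exact hf a
  | zero => exact map_zero g
  | add x y hx hy => rw [mk_add, map_add, hx, hy, eval]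
  | neg x hx => rw [mk_neg, map_neg, hx, eval]
  | mul x y hx hy => rw [mk_mul, map_mul, hx, hy, eval]
  | smul c x hx => rw [mk_smul, map_smul, hx, eval]
  | op x hx => rw [mk_op, hP, hx, eval]

end FreeNij

/-- A field acting on a nontrivial module is small relative to the universe of the module. -/
theorem small_of_nontrivial_module (k : Type v) [Field k] (A : Type u) [AddCommGroup A]
    [Module k A] [Nontrivial A] : Small.{u} k := by
  obtain ⟨a, ha⟩ := exists_ne (0 : A)
  exact small_of_injective (smul_left_injective k ha)

/-- Existence of the free Nijenhuis algebra on a nonunital associative `k`-algebra `A`. -/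
theorem exists_free_nijenhuis_on_algebra
    (k : Type v) [Field k] (A : Type u) [NonUnitalRing A]
    [Module k A] [IsScalarTower k A A] [SMulCommClass k A A] :
    ∃ (F : NijAlg.{u} k) (j : A →ₙₐ[k] F.carrier),
      ∀ (N : NijAlg.{u} k) (f : A →ₙₐ[k] N.carrier),
        ∃! fbar : F.carrier →ₙₐ[k] N.carrier,
          (∀ x : F.carrier, fbar (F.P x) = N.P (fbar x)) ∧
          (∀ a : A, fbar (j a) = f a) := by
  cases subsingleton_or_nontrivial A with
  | inl _ =>
    refine ⟨{ carrier := PUnit, P := 0, nij := fun _ _ => rfl }, 0, fun N f => ⟨0, ⟨?_, ?_⟩, ?_⟩⟩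
    · exact fun _ => (map_zero N.P).symm
    · intro a
      rw [Subsingleton.elim a 0, map_zero f]
      rfl
    · intro g _
      ext x
      exact map_zero g
  | inr _ =>
    have := small_of_nontrivial_module k A
    let e := (equivShrink.{u} k).symm
    exact ⟨FreeNij.nijAlg A e, FreeNij.incl A e, fun N f => ⟨FreeNij.lift e N f,
      ⟨FreeNij.lift_operator N f, FreeNij.lift_incl N f⟩,
      fun g hg => FreeNij.eq_lift N f g hg.1 hg.2⟩⟩
end

section
/- For every k-vector space M there exists a free Nijenhuis algebra on M: a Nijenhuis algebra (F, P) together with a k-linear map i : M → F such that for every Nijenhuis algebra (N, Q) and every k-linear map f : M → N there is a unique k-algebra homomorphism f̄ : F → N satisfying f̄ ∘ P = Q ∘ f̄ and f̄ ∘ i = f. -/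
universe u v

namespace FreeNijenhuis

/-- Formal expressions in elements of `M`, built with addition, multiplication and an operator. -/
inductive Word (M : Type u) : Type u
  | of : M → Word M
  | add : Word M → Word M → Word M
  | mul : Word M → Word M → Word M
  | op : Word M → Word M

namespace Word

section

variable {k : Type v} [Field k] {M : Type u} [AddCommGroup M] [Module k M]

/-- Scalar multiplication of expressions, pushed down to the (leftmost) leaves. Scalars are not
part of expressions, so that these stay in the universe of `M`. -/
def scale (c : k) : Word M → Word M
  | of m => of (c • m)
  | add a b => add (scale c a) (scale c b)
  | mul a b => mul (scale c a) b
  | op a => op (scale c a)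

theorem scale_scale (c d : k) (a : Word M) : scale c (scale d a) = scale (c * d) a := by
  induction a <;> simp_all [scale, mul_smul]

theorem one_scale (a : Word M) : scale (1 : k) a = a := by
  induction a <;> simp_all [scale]

/-- Evaluation of an expression in a Nijenhuis algebra. -/
def eval (N : NijAlg.{u} k) (f : M →ₗ[k] N.carrier) : Word M → N.carrier
  | of m => f m
  | add a b => eval N f a + eval N f b
  | mul a b => eval N f a * eval N f b
  | op a => N.P (eval N f a)

theorem eval_scale (N : NijAlg.{u} k) (f : M →ₗ[k] N.carrier) (c : k) (a : Word M) :
    eval N f (scale c a) = c • eval N f a := by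
  induction a <;> simp_all [scale, eval, smul_mul_assoc]

end

/-- The relations defining the free Nijenhuis algebra. -/
inductive Rel (k : Type v) [Field k] {M : Type u} [AddCommGroup M] [Module k M] :
    Word M → Word M → Prop
  | of_add (m n : M) : Rel k (of (m + n)) (add (of m) (of n))
  | add_comm (a b : Word M) : Rel k (add a b) (add b a)
  | add_assoc (a b c : Word M) : Rel k (add (add a b) c) (add a (add b c))
  | zero_add (a : Word M) : Rel k (add (of 0) a) a
  | zero_scale (a : Word M) : Rel k (scale (0 : k) a) (of 0)
  | add_scale (c d : k) (a : Word M) : Rel k (scale (c + d) a) (add (scale c a) (scale d a))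
  | mul_assoc (a b c : Word M) : Rel k (mul (mul a b) c) (mul a (mul b c))
  | add_mul (a b c : Word M) : Rel k (mul (add a b) c) (add (mul a c) (mul b c))
  | mul_add (a b c : Word M) : Rel k (mul a (add b c)) (add (mul a b) (mul a c))
  | mul_scale (c : k) (a b : Word M) : Rel k (mul a (scale c b)) (mul (scale c a) b)
  | op_add (a b : Word M) : Rel k (op (add a b)) (add (op a) (op b))
  | nij (a b : Word M) : Rel k (add (mul (op a) (op b)) (op (op (mul a b))))
      (add (op (mul (op a) b)) (op (mul a (op b))))
  | add_left {a b : Word M} (c : Word M) : Rel k a b → Rel k (add a c) (add b c)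
  | add_right {a b : Word M} (c : Word M) : Rel k a b → Rel k (add c a) (add c b)
  | mul_left {a b : Word M} (c : Word M) : Rel k a b → Rel k (mul a c) (mul b c)
  | mul_right {a b : Word M} (c : Word M) : Rel k a b → Rel k (mul c a) (mul c b)
  | op_congr {a b : Word M} : Rel k a b → Rel k (op a) (op b)

section

variable {k : Type v} [Field k] {M : Type u} [AddCommGroup M] [Module k M]

theorem Rel.scale (c : k) {a b : Word M} (h : Rel k a b) :
    Rel k (a.scale c) (b.scale c) := by
  induction h with
  | of_add m n => simpa only [Word.scale, smul_add] using Rel.of_add (c • m) (c • n)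
  | add_comm a b => exact .add_comm _ _
  | add_assoc a b d => exact .add_assoc _ _ _
  | zero_add a => simpa only [Word.scale, smul_zero] using Rel.zero_add (a.scale c)
  | zero_scale a =>
    simpa only [Word.scale, smul_zero, scale_scale, mul_zero] using Rel.zero_scale a
  | add_scale d e a =>
    simpa only [Word.scale, scale_scale, _root_.mul_add] using Rel.add_scale (c * d) (c * e) a
  | mul_assoc a b d => exact .mul_assoc _ _ _
  | add_mul a b d => exact .add_mul _ _ _
  | mul_add a b d => exact .mul_add _ _ _
  | mul_scale d a b =>
    simpa only [Word.scale, scale_scale, mul_comm] using Rel.mul_scale d (a.scale c) b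
  | op_add a b => exact .op_add _ _
  | nij a b => exact .nij _ _
  | add_left d _ ih => exact .add_left _ ih
  | add_right d _ ih => exact .add_right _ ih
  | mul_left d _ ih => exact .mul_left _ ih
  | mul_right d h _ => exact .mul_right _ h
  | op_congr _ ih => exact .op_congr ih

theorem Rel.eval_eq (N : NijAlg.{u} k) (f : M →ₗ[k] N.carrier) {a b : Word M} (h : Rel k a b) :
    eval N f a = eval N f b := by
  induction h with
  | of_add m n => exact map_add f m n
  | add_comm a b => exact _root_.add_comm _ _
  | add_assoc a b d => exact _root_.add_assoc _ _ _
  | zero_add a => simp [eval]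
  | zero_scale a => simp [eval, eval_scale]
  | add_scale d e a => simp [eval, eval_scale, add_smul]
  | mul_assoc a b d => exact _root_.mul_assoc _ _ _
  | add_mul a b d => exact _root_.add_mul _ _ _
  | mul_add a b d => exact _root_.mul_add _ _ _
  | mul_scale d a b => simp [eval, eval_scale, mul_smul_comm, smul_mul_assoc]
  | op_add a b => exact map_add N.P _ _
  | nij a b => simp [eval, N.nij]
  | add_left d _ ih => exact congrArg (· + eval N f d) ih
  | add_right d _ ih => exact congrArg (eval N f d + ·) ih
  | mul_left d _ ih => exact congrArg (· * eval N f d) ih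
  | mul_right d _ ih => exact congrArg (eval N f d * ·) ih
  | op_congr _ ih => exact congrArg N.P ih

end

end Word

open FreeNijenhuis.Word

/-- The underlying type of the free Nijenhuis algebra on `M`. -/
def Carrier (k : Type v) [Field k] (M : Type u) [AddCommGroup M] [Module k M] : Type u :=
  Quot (Rel k (M := M))

namespace Carrier

variable {k : Type v} [Field k] {M : Type u} [AddCommGroup M] [Module k M]

/-- The class of an expression in the free Nijenhuis algebra. -/
def mk (a : Word M) : Carrier k M := Quot.mk _ a

theorem mk_surjective : Function.Surjective (mk : Word M → Carrier k M) := Quot.mk_surjective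

theorem mk_eq {a b : Word M} (h : Rel k a b) : (mk a : Carrier k M) = mk b := Quot.sound h

instance : Add (Carrier k M) :=
  ⟨Quot.map₂ Word.add (fun c _ _ h => .add_right c h) (fun _ _ c h => .add_left c h)⟩

instance : Mul (Carrier k M) :=
  ⟨Quot.map₂ Word.mul (fun c _ _ h => .mul_right c h) (fun _ _ c h => .mul_left c h)⟩

instance : Zero (Carrier k M) := ⟨mk (of 0)⟩

instance : SMul k (Carrier k M) := ⟨fun c => Quot.map (scale c) fun _ _ h => h.scale c⟩

theorem mk_add (a b : Word M) : (mk (add a b) : Carrier k M) = mk a + mk b := rfl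

theorem mk_mul (a b : Word M) : (mk (mul a b) : Carrier k M) = mk a * mk b := rfl

theorem mk_scale (c : k) (a : Word M) : (mk (scale c a) : Carrier k M) = c • mk a := rfl

theorem mk_of_zero : (mk (of 0) : Carrier k M) = 0 := rfl

protected theorem add_comm (x y : Carrier k M) : x + y = y + x := by
  obtain ⟨a, rfl⟩ := mk_surjective x
  obtain ⟨b, rfl⟩ := mk_surjective y
  exact mk_eq (.add_comm a b)

protected theorem zero_add (x : Carrier k M) : 0 + x = x := by
  obtain ⟨a, rfl⟩ := mk_surjective x
  exact mk_eq (.zero_add a)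

instance : AddCommMonoid (Carrier k M) where
  add_assoc x y z := by
    obtain ⟨a, rfl⟩ := mk_surjective x
    obtain ⟨b, rfl⟩ := mk_surjective y
    obtain ⟨c, rfl⟩ := mk_surjective z
    exact mk_eq (.add_assoc a b c)
  zero_add := Carrier.zero_add
  add_zero x := by rw [Carrier.add_comm, Carrier.zero_add]
  add_comm := Carrier.add_comm
  nsmul := nsmulRec

instance : Module k (Carrier k M) where
  one_smul x := by
    obtain ⟨a, rfl⟩ := mk_surjective x
    rw [← mk_scale, one_scale]
  mul_smul c d x := by
    obtain ⟨a, rfl⟩ := mk_surjective x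
    simp only [← mk_scale, scale_scale]
  smul_zero c := by
    rw [← mk_of_zero, ← mk_scale, scale, smul_zero]
  smul_add c x y := by
    obtain ⟨a, rfl⟩ := mk_surjective x
    obtain ⟨b, rfl⟩ := mk_surjective y
    rfl
  add_smul c d x := by
    obtain ⟨a, rfl⟩ := mk_surjective x
    exact mk_eq (.add_scale c d a)
  zero_smul x := by
    obtain ⟨a, rfl⟩ := mk_surjective x
    exact mk_eq (.zero_scale a)

instance : AddCommGroup (Carrier k M) := Module.addCommMonoidToAddCommGroup k

instance : IsScalarTower k (Carrier k M) (Carrier k M) where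
  smul_assoc c x y := by
    obtain ⟨a, rfl⟩ := mk_surjective x
    obtain ⟨b, rfl⟩ := mk_surjective y
    rfl

instance : SMulCommClass k (Carrier k M) (Carrier k M) where
  smul_comm c x y := by
    obtain ⟨a, rfl⟩ := mk_surjective x
    obtain ⟨b, rfl⟩ := mk_surjective y
    exact (mk_eq (.mul_scale c a b)).symm

instance : NonUnitalRing (Carrier k M) where
  left_distrib x y z := by
    obtain ⟨a, rfl⟩ := mk_surjective x
    obtain ⟨b, rfl⟩ := mk_surjective y
    obtain ⟨c, rfl⟩ := mk_surjective z
    exact mk_eq (.mul_add a b c)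
  right_distrib x y z := by
    obtain ⟨a, rfl⟩ := mk_surjective x
    obtain ⟨b, rfl⟩ := mk_surjective y
    obtain ⟨c, rfl⟩ := mk_surjective z
    exact mk_eq (.add_mul a b c)
  zero_mul x := by
    rw [← zero_smul k (0 : Carrier k M), ← smul_eq_mul, smul_assoc, zero_smul, zero_smul]
  mul_zero x := by
    rw [← zero_smul k (0 : Carrier k M), ← smul_eq_mul, ← smul_comm, zero_smul, zero_smul]
  mul_assoc x y z := by
    obtain ⟨a, rfl⟩ := mk_surjective x
    obtain ⟨b, rfl⟩ := mk_surjective y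
    obtain ⟨c, rfl⟩ := mk_surjective z
    exact mk_eq (.mul_assoc a b c)

/-- The Nijenhuis operator of the free Nijenhuis algebra. -/
def nijOp : Carrier k M →ₗ[k] Carrier k M where
  toFun := Quot.map op fun _ _ h => .op_congr h
  map_add' x y := by
    obtain ⟨a, rfl⟩ := mk_surjective x
    obtain ⟨b, rfl⟩ := mk_surjective y
    exact mk_eq (.op_add a b)
  map_smul' c x := by
    obtain ⟨a, rfl⟩ := mk_surjective x
    rfl

theorem mk_op (a : Word M) : (mk (op a) : Carrier k M) = nijOp (mk a) := rfl

/-- The canonical map from `M` to the free Nijenhuis algebra. -/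
def ι : M →ₗ[k] Carrier k M where
  toFun m := mk (of m)
  map_add' m n := mk_eq (.of_add m n)
  map_smul' _ _ := rfl

theorem mk_of (m : M) : (mk (of m) : Carrier k M) = ι m := rfl

end Carrier

section

variable (k : Type v) [Field k] (M : Type u) [AddCommGroup M] [Module k M]

/-- The free Nijenhuis algebra on `M`. -/
def free : NijAlg.{u} k where
  carrier := Carrier k M
  P := Carrier.nijOp
  nij x y := by
    obtain ⟨a, rfl⟩ := Carrier.mk_surjective x
    obtain ⟨b, rfl⟩ := Carrier.mk_surjective y
    exact eq_sub_of_add_eq (Carrier.mk_eq (.nij a b))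

variable {k M}

/-- The morphism from the free Nijenhuis algebra on `M` induced by a linear map on `M`. -/
def lift (N : NijAlg.{u} k) (f : M →ₗ[k] N.carrier) : Carrier k M →ₙₐ[k] N.carrier where
  toFun := Quot.lift (eval N f) fun _ _ h => h.eval_eq N f
  map_smul' c x := by
    obtain ⟨a, rfl⟩ := Carrier.mk_surjective x
    exact eval_scale N f c a
  map_zero' := map_zero f
  map_add' x y := by
    obtain ⟨a, rfl⟩ := Carrier.mk_surjective x
    obtain ⟨b, rfl⟩ := Carrier.mk_surjective y
    rfl
  map_mul' x y := by
    obtain ⟨a, rfl⟩ := Carrier.mk_surjective x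
    obtain ⟨b, rfl⟩ := Carrier.mk_surjective y
    rfl

theorem lift_nijOp (N : NijAlg.{u} k) (f : M →ₗ[k] N.carrier) (x : Carrier k M) :
    lift N f (Carrier.nijOp x) = N.P (lift N f x) := by
  obtain ⟨a, rfl⟩ := Carrier.mk_surjective x
  rfl

theorem eq_lift (N : NijAlg.{u} k) (f : M →ₗ[k] N.carrier) (g : Carrier k M →ₙₐ[k] N.carrier)
    (hP : ∀ x, g (Carrier.nijOp x) = N.P (g x)) (hι : ∀ m, g (Carrier.ι m) = f m) :
    g = lift N f := by
  ext x
  obtain ⟨a, rfl⟩ := Carrier.mk_surjective x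
  change g (Carrier.mk a) = eval N f a
  induction a with
  | of m => exact hι m
  | add a b iha ihb => rw [Carrier.mk_add, map_add, iha, ihb, eval]
  | mul a b iha ihb => rw [Carrier.mk_mul, map_mul, iha, ihb, eval]
  | op a ih => rw [Carrier.mk_op, hP, ih, eval]

end

end FreeNijenhuis

/-- Existence of the free Nijenhuis algebra on a `k`-vector space `M`. -/
theorem exists_free_nijenhuis_on_module
    (k : Type v) [Field k] (M : Type u) [AddCommGroup M] [Module k M] :
    ∃ (F : NijAlg.{u} k) (i : M →ₗ[k] F.carrier),
      ∀ (N : NijAlg.{u} k) (f : M →ₗ[k] N.carrier),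
        ∃! fbar : F.carrier →ₙₐ[k] N.carrier,
          (∀ x : F.carrier, fbar (F.P x) = N.P (fbar x)) ∧
          (∀ m : M, fbar (i m) = f m) :=
  ⟨FreeNijenhuis.free k M, FreeNijenhuis.Carrier.ι, fun N f =>
    ⟨FreeNijenhuis.lift N f, ⟨FreeNijenhuis.lift_nijOp N f, fun _ => rfl⟩,
      fun g hg => FreeNijenhuis.eq_lift N f g hg.1 hg.2⟩⟩
end

section
/- Every NS algebra has a universal enveloping Nijenhuis algebra. That is, for every NS algebra (M, ≺, ≻, •) over a field k there exist a Nijenhuis algebra (U, P) and a k-linear map ρ : M → U satisfying ρ(x ≺ y) = ρ(x)·P(ρ(y)), ρ(x ≻ y) = P(ρ(x))·ρ(y), and ρ(x • y) = −P(ρ(x)·ρ(y)) for all x, y ∈ M, such that for every Nijenhuis algebra (N, Q) and every k-linear map f : M → N satisfying f(x ≺ y) = f(x)·Q(f(y)), f(x ≻ y) = Q(f(x))·f(y), and f(x • y) = −Q(f(x)·f(y)) for all x, y ∈ M, there is a unique k-algebra homomorphism f̄ : U → N with f̄ ∘ P = Q ∘ f̄ and f̄ ∘ ρ = f. -/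
universe u v

universe w

namespace NijAlg

variable {k : Type v} [Field k]

/-- The product of a family of Nijenhuis algebras. -/
def pi {ι : Type w} (N : ι → NijAlg.{u} k) : NijAlg.{max u w} k where
  carrier := ∀ i, (N i).carrier
  P := LinearMap.pi fun i => (N i).P ∘ₗ LinearMap.proj i
  nij x y := funext fun i => (N i).nij (x i) (y i)

/-- The Nijenhuis subalgebra carried by a subalgebra that is stable under the operator. -/
def ofSubalgebra (A : NijAlg.{u} k) (S : NonUnitalSubalgebra k A.carrier)
    (hS : ∀ x ∈ S, A.P x ∈ S) : NijAlg.{u} k where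
  carrier := S
  P := A.P.restrict (p := S.toSubmodule) (q := S.toSubmodule) hS
  nij x y := Subtype.ext (A.nij x y)

/-- A model of a small Nijenhuis algebra in a given universe. -/
noncomputable def shrink (A : NijAlg.{w} k) [Small.{u} A.carrier] : NijAlg.{u} k where
  carrier := Shrink.{u} A.carrier
  tower := ⟨fun c x y => (equivShrink A.carrier).symm.injective <| by
    simp [equivShrink_symm_mul, equivShrink_symm_smul, smul_mul_assoc]⟩
  comm := ⟨fun c x y => (equivShrink A.carrier).symm.injective <| by
    simp [equivShrink_symm_mul, equivShrink_symm_smul, mul_smul_comm]⟩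
  P := (Shrink.linearEquiv k A.carrier).symm.toLinearMap ∘ₗ A.P ∘ₗ
    (Shrink.linearEquiv k A.carrier).toLinearMap
  nij x y := (equivShrink A.carrier).symm.injective <| by
    simpa [equivShrink_symm_mul, equivShrink_symm_add, equivShrink_symm_sub] using
      A.nij ((equivShrink A.carrier).symm x) ((equivShrink A.carrier).symm y)

/-- The canonical isomorphism from `A.shrink` to `A`. -/
noncomputable def shrinkHom (A : NijAlg.{w} k) [Small.{u} A.carrier] :
    (shrink.{u} A).carrier →ₙₐ[k] A.carrier where
  toFun := (equivShrink A.carrier).symm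
  map_smul' := equivShrink_symm_smul
  map_zero' := equivShrink_symm_zero
  map_add' := equivShrink_symm_add
  map_mul' := equivShrink_symm_mul

theorem shrinkHom_injective (A : NijAlg.{w} k) [Small.{u} A.carrier] :
    Function.Injective (shrinkHom.{u} A) :=
  (equivShrink A.carrier).symm.injective

theorem shrinkHom_P (A : NijAlg.{w} k) [Small.{u} A.carrier] (x : (shrink.{u} A).carrier) :
    shrinkHom A ((shrink.{u} A).P x) = A.P (shrinkHom A x) :=
  (equivShrink A.carrier).symm_apply_apply _

/-- Formal expressions in the elements of `M`, built from sums, products and an operator. -/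
inductive Term (M : Type u) : Type u
  | of : M → Term M
  | add : Term M → Term M → Term M
  | mul : Term M → Term M → Term M
  | op : Term M → Term M

section Eval

variable {M : Type u} [AddCommGroup M] [Module k M] (A : NijAlg.{w} k) (f : M →ₗ[k] A.carrier)

/-- The value of a formal expression in a Nijenhuis algebra. -/
def eval : Term M → A.carrier
  | .of m => f m
  | .add s t => eval s + eval t
  | .mul s t => eval s * eval t
  | .op t => A.P (eval t)

theorem exists_eval_eq_smul (c : k) (t : Term M) : ∃ s, eval A f s = c • eval A f t := by
  induction t with
  | of m => exact ⟨.of (c • m), f.map_smul c m⟩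
  | add s t hs ht =>
    obtain ⟨s', hs⟩ := hs
    obtain ⟨t', ht⟩ := ht
    exact ⟨.add s' t', by simp only [eval, hs, ht, smul_add]⟩
  | mul s t hs _ =>
    obtain ⟨s', hs⟩ := hs
    exact ⟨.mul s' t, by simp only [eval, hs, smul_mul_assoc]⟩
  | op t ht =>
    obtain ⟨t', ht⟩ := ht
    exact ⟨.op t', by simp only [eval, ht, map_smul]⟩

/-- The subalgebra generated by the image of `f` under the operations and the operator. -/
def evalRange : NonUnitalSubalgebra k A.carrier where
  carrier := Set.range (eval A f)
  zero_mem' := ⟨.of 0, f.map_zero⟩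
  add_mem' := by
    rintro _ _ ⟨s, rfl⟩ ⟨t, rfl⟩
    exact ⟨.add s t, rfl⟩
  mul_mem' := by
    rintro _ _ ⟨s, rfl⟩ ⟨t, rfl⟩
    exact ⟨.mul s t, rfl⟩
  smul_mem' := by
    rintro c _ ⟨t, rfl⟩
    exact exists_eval_eq_smul A f c t

/-- The Nijenhuis subalgebra generated by the image of `f`. -/
def adjoin : NijAlg.{w} k :=
  A.ofSubalgebra (evalRange A f) <| by
    rintro _ ⟨t, rfl⟩
    exact ⟨.op t, rfl⟩

instance : Small.{u} (adjoin A f).carrier :=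
  inferInstanceAs (Small.{u} (Set.range (eval A f)))

/-- The Nijenhuis subalgebra generated by the image of `f`, in the universe of the source. -/
noncomputable def smallAdjoin : NijAlg.{u} k := shrink.{u} (adjoin A f)

/-- The inclusion of the generated Nijenhuis subalgebra. -/
noncomputable def smallAdjoinHom : (smallAdjoin A f).carrier →ₙₐ[k] A.carrier :=
  (NonUnitalSubalgebraClass.subtype (evalRange A f) : evalRange A f →ₙₐ[k] A.carrier).comp
    (shrinkHom.{u} (adjoin A f))

theorem smallAdjoinHom_injective : Function.Injective (smallAdjoinHom A f) :=
  Subtype.val_injective.comp (shrinkHom_injective (adjoin A f))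

theorem smallAdjoinHom_P (x : (smallAdjoin A f).carrier) :
    smallAdjoinHom A f ((smallAdjoin A f).P x) = A.P (smallAdjoinHom A f x) :=
  congrArg Subtype.val (shrinkHom_P (adjoin A f) x)

/-- The generating map of the generated Nijenhuis subalgebra. -/
noncomputable def smallAdjoinOf : M →ₗ[k] (smallAdjoin A f).carrier :=
  (Shrink.linearEquiv k (adjoin A f).carrier).symm.toLinearMap ∘ₗ
    (f.codRestrict (evalRange A f).toSubmodule fun m => ⟨.of m, rfl⟩ :
      M →ₗ[k] (evalRange A f).toSubmodule)

theorem smallAdjoinHom_of (m : M) : smallAdjoinHom A f (smallAdjoinOf A f m) = f m :=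
  congrArg Subtype.val ((equivShrink (adjoin A f).carrier).symm_apply_apply _)

theorem eval_map {B : NijAlg.{u} k} (g : B.carrier →ₙₐ[k] A.carrier)
    (hg : ∀ x, g (B.P x) = A.P (g x)) (r : M →ₗ[k] B.carrier) (hr : ∀ m, g (r m) = f m)
    (t : Term M) : g (eval B r t) = eval A f t := by
  induction t with
  | of m => exact hr m
  | add s t hs ht => simp only [eval, map_add, hs, ht]
  | mul s t hs ht => simp only [eval, map_mul, hs, ht]
  | op t ht => simp only [eval, hg, ht]

theorem eval_smallAdjoinOf_surjective :
    Function.Surjective (eval (smallAdjoin A f) (smallAdjoinOf A f)) := by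
  intro x
  obtain ⟨t, ht⟩ : smallAdjoinHom A f x ∈ Set.range (eval A f) :=
    (shrinkHom (adjoin A f) x).property
  refine ⟨t, smallAdjoinHom_injective A f ?_⟩
  rw [eval_map A f _ (smallAdjoinHom_P A f) _ (smallAdjoinHom_of A f), ht]

end Eval

/-- A Nijenhuis algebra together with a homomorphism from `(M, prec, succ, bul)` to its induced
NS algebra. -/
structure NSHom {M : Type u} [AddCommGroup M] [Module k M]
    (prec succ bul : M →ₗ[k] M →ₗ[k] M) where
  target : NijAlg.{u} k
  map : M →ₗ[k] target.carrier
  map_prec : ∀ x y, map (prec x y) = map x * target.P (map y)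
  map_succ : ∀ x y, map (succ x y) = target.P (map x) * map y
  map_bul : ∀ x y, map (bul x y) = - target.P (map x * map y)

end NijAlg

open NijAlg

/-- Every NS algebra has a universal enveloping Nijenhuis algebra. -/
theorem exists_universal_enveloping_nijenhuis_of_NS
    (k : Type v) [Field k] (M : Type u) [AddCommGroup M] [Module k M]
    (prec succ bul : M →ₗ[k] M →ₗ[k] M)
    (h1 : ∀ x y z : M,
      prec (prec x y) z = prec x (prec y z + succ y z + bul y z))
    (h2 : ∀ x y z : M, prec (succ x y) z = succ x (prec y z))
    (h3 : ∀ x y z : M,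
      succ (prec x y + succ x y + bul x y) z = succ x (succ y z))
    (h4 : ∀ x y z : M,
      bul (prec x y + succ x y + bul x y) z + prec (bul x y) z
        = succ x (bul y z) + bul x (prec y z + succ y z + bul y z)) :
    ∃ (U : NijAlg.{u} k) (ρ : M →ₗ[k] U.carrier),
      (∀ x y : M, ρ (prec x y) = ρ x * U.P (ρ y)) ∧
      (∀ x y : M, ρ (succ x y) = U.P (ρ x) * ρ y) ∧
      (∀ x y : M, ρ (bul x y) = - U.P (ρ x * ρ y)) ∧
      ∀ (N : NijAlg.{u} k) (f : M →ₗ[k] N.carrier),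
        (∀ x y : M, f (prec x y) = f x * N.P (f y)) →
        (∀ x y : M, f (succ x y) = N.P (f x) * f y) →
        (∀ x y : M, f (bul x y) = - N.P (f x * f y)) →
        ∃! fbar : U.carrier →ₙₐ[k] N.carrier,
          (∀ u : U.carrier, fbar (U.P u) = N.P (fbar u)) ∧
          (∀ m : M, fbar (ρ m) = f m) := by
  let A := NijAlg.pi fun i : NSHom prec succ bul => i.target
  let F : M →ₗ[k] A.carrier := LinearMap.pi fun i : NSHom prec succ bul => i.map
  have hP := smallAdjoinHom_P A F
  have hof := smallAdjoinHom_of A F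
  have hinj := smallAdjoinHom_injective A F
  refine ⟨smallAdjoin A F, smallAdjoinOf A F, fun x y => hinj ?_, fun x y => hinj ?_,
    fun x y => hinj ?_, fun N f hprec hsucc hbul => ?_⟩
  · rw [map_mul, hP, hof, hof, hof]
    exact funext fun i => i.map_prec x y
  · rw [map_mul, hP, hof, hof, hof]
    exact funext fun i => i.map_succ x y
  · rw [map_neg, hP, map_mul, hof, hof, hof]
    exact funext fun i => i.map_bul x y
  · let i : NSHom prec succ bul := ⟨N, f, hprec, hsucc, hbul⟩
    let p : A.carrier →ₙₐ[k] N.carrier :=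
      { toFun := fun a => a i
        map_smul' := fun _ _ => rfl
        map_zero' := rfl
        map_add' := fun _ _ => rfl
        map_mul' := fun _ _ => rfl }
    refine ⟨p.comp (smallAdjoinHom A F), ⟨fun x => congrFun (hP x) i,
      fun m => congrFun (hof m) i⟩, fun g hg => ?_⟩
    ext x
    obtain ⟨t, rfl⟩ := eval_smallAdjoinOf_surjective A F x
    rw [eval_map N f g hg.1 _ hg.2]
    exact (eval_map N f (p.comp (smallAdjoinHom A F)) (fun x => congrFun (hP x) i) _
      (fun m => congrFun (hof m) i) t).symm
end
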